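/- arXiv:1702.01427 — 4 statements merged into one kernel-verified Lean document; each statement's English description precedes it below -/
import Mathlib

section
/- Define u : ℝ → ℝ by u(t) = −1 for t ∈ [0,1) and u(t) = (t+1)/2 for t ≥ 1 (the energetic weak solution u^weak of the scalar example). Then u satisfies the global stability inequality: for every t ≥ 0 and every z ∈ ℝ, E(t, u(t)) ≤ E(t, z) + |z − u(t)|, i.e. W₀(u(t)) − t·u(t) ≤ W₀(z) − t·z + |z − u(t)|. -/
/-- The double-well potential of the scalar example: `W₀(z) = min{z(z+2), z(z−2)}`. -/
noncomputable def W0 (z : ℝ) : ℝ := min (z * (z + 2)) (z * (z - 2))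

/-- The energetic weak solution of the scalar example. -/
noncomputable def uweak (t : ℝ) : ℝ := if t < 1 then -1 else (t + 1) / 2

/-- `u^weak` satisfies the global stability inequality
`E(t, u(t)) ≤ E(t, z) + |z − u(t)|`, where `E(t,z) = W₀(z) − t·z`. -/
theorem uweak_global_stability (t : ℝ) (ht : 0 ≤ t) (z : ℝ) :
    W0 (uweak t) - t * uweak t ≤ W0 z - t * z + |z - uweak t| := by
  have h₁ := le_abs_self (z - uweak t)
  have h₂ := neg_abs_le (z - uweak t)
  have h₃ := abs_nonneg (z - uweak t)
  by_cases h : t < 1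
  · have hu : uweak t = -1 := if_pos h
    have hW : W0 (-1) = -1 := by norm_num [W0]
    rw [hu] at h₁ h₂ h₃ ⊢
    rw [hW]
    rcases le_total 0 z with hz | hz
    · have hWz : W0 z = z * (z - 2) := min_eq_right (by linarith)
      rw [hWz]
      nlinarith [sq_nonneg (z - (1 + t) / 2), mul_nonneg (sub_nonneg.2 h.le) ht]
    · have hWz : W0 z = z * (z + 2) := min_eq_left (by linarith)
      rw [hWz]
      have htz : t * (z + 1) ≤ |z - -1| := by
        have ha : t * (z + 1) ≤ t * |z - -1| := mul_le_mul_of_nonneg_left (by linarith) ht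
        have hb : t * |z - -1| ≤ 1 * |z - -1| := mul_le_mul_of_nonneg_right h.le h₃
        linarith
      linarith [sq_nonneg (z + 1)]
  · have hu : uweak t = (t + 1) / 2 := if_neg h
    obtain ⟨u, rfl⟩ : ∃ u, t = 2 * u - 1 := ⟨(t + 1) / 2, by ring⟩
    have hu' : uweak (2 * u - 1) = u := by rw [hu]; ring
    have hu₁ : 1 ≤ u := by linarith
    have hW : W0 u = u * (u - 2) := min_eq_right (by nlinarith)
    rw [hu'] at h₁ h₂ ⊢
    rw [hW]
    rcases le_total 0 z with hz | hz
    · have hWz : W0 z = z * (z - 2) := min_eq_right (by linarith)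
      rw [hWz]
      linarith [sq_nonneg (z - u)]
    · have hWz : W0 z = z * (z + 2) := min_eq_left (by linarith)
      rw [hWz]
      nlinarith [sq_nonneg z, sq_nonneg u, mul_nonneg (neg_nonneg.2 hz) (sub_nonneg.2 hu₁)]
end

section
/- Define u : ℝ → ℝ by u(t) = −1 for t ∈ [0,1) and u(t) = (t+1)/2 for t ≥ 1 (the energetic weak solution u^weak of the scalar example). Then u satisfies the energy balance: for every t ≥ 0, E(t, u(t)) − E(0, u(0)) = −∫₀ᵗ u(s) ds − V(t), where V(t) is the total variation of u over the interval [0, t] (in particular V(t) is finite for every t). Note ∂ₛE(s,z) = −f'(s)·z = −z since f(s) = s, so −∫₀ᵗ u(s) ds is the work term, and the total R₁-variation coincides with the usual total variation since R₁ = |·|. -/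
open MeasureTheory

theorem monotone_uweak : Monotone uweak := by
  intro a b hab
  unfold uweak
  split_ifs <;> linarith

theorem eVariationOn_uweak_Icc (t : ℝ) :
    eVariationOn uweak (Set.Icc 0 t) = ENNReal.ofReal (uweak t - uweak 0) := by
  simpa using (monotone_uweak.monotoneOn Set.univ).eVariationOn_eq
    (Set.mem_univ 0) (Set.mem_univ t)

theorem integral_uweak_of_le_one {t : ℝ} (ht : 0 ≤ t) (h1 : t ≤ 1) :
    ∫ s in (0 : ℝ)..t, uweak s = -t := by
  have h : ∫ s in (0 : ℝ)..t, uweak s = ∫ _ in (0 : ℝ)..t, (-1 : ℝ) := by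
    apply intervalIntegral.integral_congr_Ioo_of_le ht
    intro s hs
    exact if_pos (hs.2.trans_le h1)
  rw [h]
  simp

theorem integral_uweak_of_one_le {t : ℝ} (h1 : 1 ≤ t) :
    ∫ s in (0 : ℝ)..t, uweak s = ((t + 1) / 2) ^ 2 - 2 := by
  have h : ∫ s in (1 : ℝ)..t, uweak s = ∫ s in (1 : ℝ)..t, (s + 1) / 2 := by
    apply intervalIntegral.integral_congr
    rw [Set.uIcc_of_le h1]
    intro s hs
    exact if_neg (not_lt.2 hs.1)
  rw [← intervalIntegral.integral_add_adjacent_intervals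
    monotone_uweak.intervalIntegrable (b := 1) monotone_uweak.intervalIntegrable,
    integral_uweak_of_le_one zero_le_one le_rfl, h, intervalIntegral.integral_div,
    intervalIntegral.integral_add (by simp) (by simp)]
  simp only [integral_id, intervalIntegral.integral_const, smul_eq_mul]
  ring

/-- `u^weak` satisfies the energy balance
`E(t, u(t)) − E(0, u(0)) = −∫₀ᵗ u(s) ds − Var(u; [0,t])`, where `E(t,z) = W₀(z) − t·z`;
in particular the total variation of `u^weak` on `[0,t]` is finite. -/
theorem uweak_energy_balance (t : ℝ) (ht : 0 ≤ t) :
    eVariationOn uweak (Set.Icc 0 t) ≠ ⊤ ∧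
    (W0 (uweak t) - t * uweak t) - (W0 (uweak 0) - 0 * uweak 0) =
      -(∫ s in (0:ℝ)..t, uweak s) - (eVariationOn uweak (Set.Icc 0 t)).toReal := by
  have hV := eVariationOn_uweak_Icc t
  refine ⟨hV ▸ ENNReal.ofReal_ne_top, ?_⟩
  rw [hV, ENNReal.toReal_ofReal (sub_nonneg.2 (monotone_uweak ht))]
  have h0 : uweak 0 = -1 := if_pos zero_lt_one
  have hW : W0 (-1) = -1 := by norm_num [W0]
  rcases lt_or_ge t 1 with h1 | h1
  · have hu : uweak t = -1 := if_pos h1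
    rw [integral_uweak_of_le_one ht h1.le, hu, h0, hW]
    ring
  · have hu : uweak t = (t + 1) / 2 := if_neg (not_lt.2 h1)
    have hWt : W0 ((t + 1) / 2) = (t + 1) / 2 * ((t + 1) / 2 - 2) :=
      min_eq_right (by nlinarith)
    rw [integral_uweak_of_one_le h1, hu, h0, hW, hWt]
    ring
end

section
/- Let w : ℝ → ℝ be Lipschitz continuous with w(0) = 0, and suppose that for almost every t ∈ (0,2) there exists d ∈ ℝ such that w is differentiable at t with derivative d and t − w(t) ∈ ∂R₁(d), i.e. |y| ≥ |d| + (t − w(t))·(y − d) for all y ∈ ℝ. Then w(t) = max{t − 1, 0} for all t ∈ [0,2]. In other words, v(t) = max{t−1,0} is the unique strong solution of the scalar rate-independent system ∂|v̇(t)| ∋ t − v(t) on [0,2] with v(0) = 0. -/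
open MeasureTheory

/-- An absolutely continuous function whose derivative is nonpositive almost everywhere does not
increase between the endpoints. -/
lemma AbsolutelyContinuousOnInterval.le_of_ae_deriv_nonpos {f : ℝ → ℝ} {a b : ℝ}
    (hf : AbsolutelyContinuousOnInterval f a b) (hab : a ≤ b)
    (hderiv : ∀ᵐ t ∂(volume.restrict (Set.Ioo a b)), deriv f t ≤ 0) : f b ≤ f a := by
  rw [← sub_nonpos, ← hf.integral_deriv_eq_sub, intervalIntegral.integral_of_le hab,
    integral_Ioc_eq_integral_Ioo]
  exact integral_nonpos_of_ae hderiv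

/-- If `z` is a subgradient of the absolute value at `d`, then `z * d` dominates `|d|`. -/
lemma abs_le_mul_of_abs_subgradient {d z : ℝ} (h : ∀ y : ℝ, |y| ≥ |d| + z * (y - d)) :
    |d| ≤ z * d := by
  have := h 0
  rw [abs_zero] at this
  linarith

/-- Subgradients of the absolute value are at most one. -/
lemma le_one_of_abs_subgradient {d z : ℝ} (h : ∀ y : ℝ, |y| ≥ |d| + z * (y - d)) : z ≤ 1 := by
  have h₁ := h (d + 1)
  have h₂ := abs_add_le d 1
  rw [abs_one] at h₂
  linarith

/-- `max (t - 1) 0` has, away from `t = 1`, a derivative satisfying the monotonicity estimate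
against any subgradient pair `(d, t - x)` of the absolute value. -/
lemma exists_hasDerivAt_max_sub_one_mul_nonpos {t x d : ℝ} (ht : 0 < t) (ht1 : t ≠ 1)
    (h : ∀ y : ℝ, |y| ≥ |d| + (t - x) * (y - d)) :
    ∃ e : ℝ, HasDerivAt (fun s : ℝ => max (s - 1) 0) e t ∧
      (x - max (t - 1) 0) * (d - e) ≤ 0 := by
  have hd := abs_le_mul_of_abs_subgradient h
  rcases lt_or_gt_of_ne ht1 with hlt | hgt
  · refine ⟨0, (hasDerivAt_const t (0 : ℝ)).congr_of_eventuallyEq ?_, ?_⟩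
    · filter_upwards [Iio_mem_nhds hlt] with s hs
      exact max_eq_right (sub_nonpos.2 (le_of_lt hs))
    · rw [max_eq_right (by linarith)]
      have : t * d ≤ |d| := by nlinarith [le_abs_self d, abs_nonneg d]
      linarith
  · refine ⟨1, ((hasDerivAt_id t).sub_const 1).congr_of_eventuallyEq ?_, ?_⟩
    · filter_upwards [Ioi_mem_nhds hgt] with s hs
      exact max_eq_left (sub_nonneg.2 (le_of_lt hs))
    · rw [max_eq_left (by linarith)]
      linarith [le_abs_self d, le_one_of_abs_subgradient h]

/-- `v(t) = max{t−1, 0}` is the unique strong solution of the scalar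
rate-independent system `∂|v̇(t)| ∋ t − v(t)` on `[0,2]` with `v(0) = 0`: any Lipschitz
function `w` with `w(0) = 0` satisfying the differential inclusion for a.e. `t ∈ (0,2)`
coincides with it on `[0,2]`. -/
theorem scalar_example_uniqueness (w : ℝ → ℝ)
    (hw : ∃ K : NNReal, LipschitzWith K w) (h0 : w 0 = 0)
    (hsol : ∀ᵐ t ∂(volume.restrict (Set.Ioo (0:ℝ) 2)),
      ∃ d : ℝ, HasDerivAt w d t ∧ ∀ y : ℝ, |y| ≥ |d| + (t - w t) * (y - d)) :
    ∀ t ∈ Set.Icc (0:ℝ) 2, w t = max (t - 1) 0 := by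
  intro T hT
  obtain ⟨K, hK⟩ := hw
  have hlip : LipschitzWith (K + 1) (fun s => w s - max (s - 1) 0) :=
    hK.sub ((LipschitzWith.of_le_add fun s r => by
      rw [Real.dist_eq]; linarith [le_abs_self (s - r)]).max_const 0)
  have hac := (hlip.lipschitzOnWith (s := Set.uIcc 0 T)).absolutelyContinuousOnInterval
  have hle := (hac.fun_mul hac).le_of_ae_deriv_nonpos hT.1 (by
    filter_upwards [ae_restrict_of_ae_restrict_of_subset (Set.Ioo_subset_Ioo_right hT.2) hsol,
      ae_restrict_mem measurableSet_Ioo, ae_restrict_of_ae (Measure.ae_ne volume (1 : ℝ))]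
      with t ⟨d, hd, hsub⟩ ht ht1
    obtain ⟨e, he, hmono⟩ := exists_hasDerivAt_max_sub_one_mul_nonpos ht.1 ht1 hsub
    have hdiff := hd.fun_sub he
    rw [(hdiff.fun_mul hdiff).deriv]
    linarith)
  have hzero : w T - max (T - 1) 0 = 0 := by
    norm_num [h0] at hle
    nlinarith
  linarith
end

section
/- Let 0 < T ≤ 3 and let w : ℝ → ℝ be Lipschitz continuous with w(0) = −1 such that for almost every t ∈ (0,T) there exists d ∈ ℝ with: w differentiable at t with derivative d, W₀ differentiable at w(t), and t − W₀'(w(t)) ∈ ∂R₁(d), i.e. |y| ≥ |d| + (t − W₀'(w(t)))·(y − d) for all y ∈ ℝ. Then w(t) = u^strong(t) for all t ∈ [0,T], where u^strong(t) = −1 for t ∈ [0,1) and u^strong(t) = (t−3)/2 for t ∈ [1,3]. That is, on [0,3] the strong solution of the scalar example with initial value −1 is unique within the class of strong solutions. -/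
open MeasureTheory

open Set Filter Topology

lemma W0_eq_sq_sub_abs (z : ℝ) : W0 z = z ^ 2 - 2 * |z| := by
  unfold W0
  rcases le_total 0 z with h | h
  · rw [abs_of_nonneg h, min_eq_right (by linarith)]
    ring
  · rw [abs_of_nonpos h, min_eq_left (by linarith)]
    ring

lemma not_differentiableAt_W0_zero : ¬ DifferentiableAt ℝ W0 0 := by
  intro h
  apply not_differentiableAt_abs_zero
  have habs : (abs : ℝ → ℝ) = fun z => (z ^ 2 - W0 z) / 2 := by
    funext z
    rw [W0_eq_sq_sub_abs]
    ring
  rw [habs]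
  fun_prop

lemma deriv_W0_of_neg {z : ℝ} (hz : z < 0) : deriv W0 z = 2 * z + 2 := by
  have heq : W0 =ᶠ[𝓝 z] fun x => x ^ 2 + 2 * x := by
    filter_upwards [Iio_mem_nhds hz] with x hx
    rw [W0_eq_sq_sub_abs, abs_of_neg hx]
    ring
  rw [heq.deriv_eq]
  exact (((hasDerivAt_pow 2 z).add ((hasDerivAt_id z).const_mul 2)).congr_deriv
    (by norm_num)).deriv

lemma deriv_W0_of_pos {z : ℝ} (hz : 0 < z) : deriv W0 z = 2 * z - 2 := by
  have heq : W0 =ᶠ[𝓝 z] fun x => x ^ 2 - 2 * x := by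
    filter_upwards [Ioi_mem_nhds hz] with x hx
    rw [W0_eq_sq_sub_abs, abs_of_pos hx]
  rw [heq.deriv_eq]
  exact (((hasDerivAt_pow 2 z).sub ((hasDerivAt_id z).const_mul 2)).congr_deriv
    (by norm_num)).deriv

/-- A subgradient `s` of the absolute value at `d` lies in `[-1, 1]` and satisfies `s * d = |d|`. -/
lemma abs_subgradient {s d : ℝ} (h : ∀ y : ℝ, |y| ≥ |d| + s * (y - d)) :
    -1 ≤ s ∧ s ≤ 1 ∧ s * d = |d| := by
  have hzero := h 0
  have hdouble := h (2 * d)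
  rw [abs_zero] at hzero
  rw [abs_mul, abs_two] at hdouble
  have hsd : s * d = |d| := by nlinarith
  have hpos := h 1
  have hneg := h (-1)
  rw [abs_neg] at hneg
  rw [abs_one] at hpos hneg
  exact ⟨by nlinarith, by nlinarith, hsd⟩

/-- A closed set containing almost every point of `(a, b)` contains `[a, b]`. -/
lemma IsClosed.Icc_subset_of_ae_restrict_Ioo {S : Set ℝ} (hS : IsClosed S) {a b : ℝ} (hab : a < b)
    (h : ∀ᵐ t ∂(volume.restrict (Ioo a b)), t ∈ S) : Icc a b ⊆ S := by
  rw [← closure_Ioo hab.ne]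
  refine closure_minimal ?_ hS
  rw [ae_restrict_iff' measurableSet_Ioo] at h
  have hempty : Ioo a b \ S = ∅ := by
    refine (isOpen_Ioo.sdiff hS).eq_empty_of_measure_zero (μ := volume) ?_
    refine measure_mono_null ?_ (ae_iff.1 h)
    rintro t ⟨ht, htS⟩
    simpa [ht.1, ht.2] using htS
  exact sdiff_eq_bot_iff.1 hempty

lemma LipschitzWith.sub_le_mul_of_ae_deriv_le {f : ℝ → ℝ} {K : NNReal} (hf : LipschitzWith K f)
    {a b c : ℝ} (hab : a ≤ b) (h : ∀ᵐ t ∂(volume.restrict (Ioo a b)), deriv f t ≤ c) :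
    f b - f a ≤ c * (b - a) := by
  have hac : AbsolutelyContinuousOnInterval f a b :=
    (hf.lipschitzOnWith (s := uIcc a b)).absolutelyContinuousOnInterval
  have hmono := intervalIntegral.integral_mono_ae_restrict (μ := volume) hab
    hac.intervalIntegrable_deriv (intervalIntegrable_const (c := c))
    (by rwa [← restrict_Ioo_eq_restrict_Icc])
  rw [hac.integral_deriv_eq_sub, intervalIntegral.integral_const, smul_eq_mul] at hmono
  linarith

lemma LipschitzWith.mul_le_sub_of_ae_le_deriv {f : ℝ → ℝ} {K : NNReal} (hf : LipschitzWith K f)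
    {a b c : ℝ} (hab : a ≤ b) (h : ∀ᵐ t ∂(volume.restrict (Ioo a b)), c ≤ deriv f t) :
    c * (b - a) ≤ f b - f a := by
  have hneg := hf.neg.sub_le_mul_of_ae_deriv_le (c := -c) hab (by
    filter_upwards [h] with t ht
    rw [deriv.neg]
    linarith)
  simp only [Pi.neg_apply] at hneg
  linarith

/-- On `[0,T]` with `0 < T ≤ 3`, the strong solution of the scalar example
with initial value `−1` is unique within the class of strong solutions: any Lipschitz `w`
with `w(0) = −1` satisfying the differential inclusion a.e. on `(0,T)` coincides with
`u^strong(t)` (`= −1` for `t < 1`, `= (t−3)/2` for `t ≥ 1`) on `[0,T]`. -/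
theorem scalar_example_strong_uniqueness (T : ℝ) (hT0 : 0 < T) (hT3 : T ≤ 3)
    (w : ℝ → ℝ) (hw : ∃ K : NNReal, LipschitzWith K w) (h0 : w 0 = -1)
    (hsol : ∀ᵐ t ∂(volume.restrict (Set.Ioo (0:ℝ) T)),
      ∃ d : ℝ, HasDerivAt w d t ∧ DifferentiableAt ℝ W0 (w t) ∧
        ∀ y : ℝ, |y| ≥ |d| + (t - deriv W0 (w t)) * (y - d)) :
    ∀ t ∈ Set.Icc (0:ℝ) T, w t = if t < 1 then -1 else (t - 3) / 2 := by
  obtain ⟨K, hK⟩ := hw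
  have hcont : Continuous w := hK.continuous
  -- Stability forces `w` into one of two separated bands.
  have hbands : Icc 0 T ⊆
      {t | (t - 3) / 2 ≤ w t ∧ w t ≤ (t - 1) / 2 ∧ w t ≤ 0} ∪ {t | (t + 1) / 2 ≤ w t} := by
    refine IsClosed.Icc_subset_of_ae_restrict_Ioo ?_ hT0 ?_
    · have hleft : Continuous fun t : ℝ => (t - 3) / 2 := by fun_prop
      have hmid : Continuous fun t : ℝ => (t - 1) / 2 := by fun_prop
      have hright : Continuous fun t : ℝ => (t + 1) / 2 := by fun_prop
      exact ((isClosed_le hleft hcont).inter ((isClosed_le hcont hmid).inter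
        (isClosed_le hcont continuous_const))).union (isClosed_le hright hcont)
    · filter_upwards [hsol] with t ht
      obtain ⟨d, -, hdiff, hsub⟩ := ht
      obtain ⟨hs1, hs2, -⟩ := abs_subgradient hsub
      rcases lt_trichotomy (w t) 0 with hneg | hzero | hpos
      · rw [deriv_W0_of_neg hneg] at hs1 hs2
        exact Or.inl ⟨by linarith, by linarith, hneg.le⟩
      · exact absurd (hzero ▸ hdiff) not_differentiableAt_W0_zero
      · rw [deriv_W0_of_pos hpos] at hs1 hs2
        exact Or.inr (show (t + 1) / 2 ≤ w t by linarith)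
  have hlow : ∀ t ∈ Icc 0 T, (t - 3) / 2 ≤ w t ∧ w t ≤ (t - 1) / 2 ∧ w t ≤ 0 := by
    intro t ht
    refine (hbands ht).resolve_right fun hup => ?_
    have hup : (t + 1) / 2 ≤ w t := hup
    have hmem : (1 / 4 : ℝ) ∈ Icc (w 0) (w t) := ⟨by linarith, by linarith [ht.1]⟩
    obtain ⟨r, hr, hwr⟩ := intermediate_value_Icc ht.1 hcont.continuousOn hmem
    rcases hbands ⟨hr.1, hr.2.trans ht.2⟩ with ⟨-, -, h⟩ | h
    · linarith
    · have h : (r + 1) / 2 ≤ w r := h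
      linarith [hr.1]
  have hderiv : ∀ᵐ t ∂(volume.restrict (Ioo 0 T)),
      0 ≤ deriv w t ∧ deriv w t ≤ 1 / 2 ∧ ((t - 3) / 2 < w t → deriv w t = 0) := by
    filter_upwards [hsol, ae_restrict_mem measurableSet_Ioo] with t ⟨d, hd, hdiff, hsub⟩ ht
    obtain ⟨-, -, hsd⟩ := abs_subgradient hsub
    have hnhds : ∀ᶠ r in 𝓝 t, r ∈ Icc 0 T := Icc_mem_nhds ht.1 ht.2
    have hne : w t ≠ 0 := fun hzero => not_differentiableAt_W0_zero (hzero ▸ hdiff)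
    rw [deriv_W0_of_neg ((hlow t ⟨ht.1.le, ht.2.le⟩).2.2.lt_of_ne hne)] at hsd
    have hshift : HasDerivAt (fun r => w r - r / 2) (d - 1 / 2) t :=
      hd.sub ((hasDerivAt_id t).div_const 2)
    rw [hd.deriv]
    rcases lt_trichotomy d 0 with hneg | rfl | hpos
    · rw [abs_of_neg hneg] at hsd
      have hs : t - (2 * w t + 2) = -1 := mul_right_cancel₀ hneg.ne (by linarith)
      have hmax : IsLocalMax (fun r => w r - r / 2) t := by
        filter_upwards [hnhds] with r hr
        linarith [(hlow r hr).2.1]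
      linarith [hmax.hasDerivAt_eq_zero hshift]
    · norm_num
    · rw [abs_of_pos hpos] at hsd
      have hs : t - (2 * w t + 2) = 1 := mul_right_cancel₀ hpos.ne' (by linarith)
      have hmin : IsLocalMin (fun r => w r - r / 2) t := by
        filter_upwards [hnhds] with r hr
        linarith [(hlow r hr).1]
      have hhalf := hmin.hasDerivAt_eq_zero hshift
      exact ⟨hpos.le, by linarith, fun h => by linarith⟩
  have hderiv_on : ∀ {a b : ℝ}, 0 ≤ a → b ≤ T → ∀ᵐ t ∂(volume.restrict (Ioo a b)),
      0 ≤ deriv w t ∧ deriv w t ≤ 1 / 2 ∧ ((t - 3) / 2 < w t → deriv w t = 0) :=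
    fun ha hb => ae_restrict_of_ae_restrict_of_subset (Ioo_subset_Ioo ha hb) hderiv
  have hge : ∀ t ∈ Icc 0 T, -1 ≤ w t := by
    intro t ht
    have := hK.mul_le_sub_of_ae_le_deriv ht.1 ((hderiv_on le_rfl ht.2).mono fun _ h => h.1)
    linarith
  have hconst : ∀ t ∈ Icc 0 T, t ≤ 1 → w t = -1 := by
    intro t ht ht1
    refine le_antisymm ?_ (hge t ht)
    have := hK.sub_le_mul_of_ae_deriv_le (c := 0) ht.1 (by
      filter_upwards [hderiv_on le_rfl ht.2, ae_restrict_mem measurableSet_Ioo] with r hr hmem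
      refine (hr.2.2 ?_).le
      linarith [hge r ⟨hmem.1.le, hmem.2.le.trans ht.2⟩, hmem.2])
    linarith
  intro t ht
  split_ifs with ht1
  · exact hconst t ht ht1.le
  · have ht1 : 1 ≤ t := not_lt.1 ht1
    have hw1 := hconst 1 ⟨zero_le_one, ht1.trans ht.2⟩ le_rfl
    have := hK.sub_le_mul_of_ae_deriv_le ht1
      ((hderiv_on zero_le_one ht.2).mono fun _ h => h.2.1)
    exact le_antisymm (by linarith) (hlow t ht).1
end
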